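/- (Full-range orthogonality of discrete singular eigenfunctions.) Let w and w' be real numbers with |w| > 1, |w'| > 1, w ≠ w', and Λ^m(w) = Λ^m(w') = 0. Then ∫_{−1}^{1} μ φ^m(w,μ) φ^m(w',μ) (1−μ²)^m dμ = 0, where φ^m(w,μ) = (ϖ w / 2) g^m(w,μ)/(w−μ). -/

import Mathlib

open MeasureTheory Filter

/-- Legendre polynomial via Rodrigues' formula. -/
noncomputable def legendreP (l : ℕ) (x : ℝ) : ℝ :=
  (1 / (2 ^ l * (Nat.factorial l : ℝ))) *
    iteratedDeriv l (fun y : ℝ => (y ^ 2 - 1) ^ l) x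

/-- `p_l^m(μ) = √((l−m)!/(l+m)!) (d/dμ)^m P_l(μ)`; it vanishes for `l < m`
(in particular the convention `p_{m−1}^m = 0` holds). -/
noncomputable def pml (m l : ℕ) (μ : ℝ) : ℝ :=
  Real.sqrt ((Nat.factorial (l - m) : ℝ) / (Nat.factorial (l + m) : ℝ)) *
    iteratedDeriv m (legendreP l) μ

/-- `q_l^m(w) = (1/2) ∫_{−1}^{1} p_l^m(μ)/(w−μ) (1−μ²)^m dμ`. -/
noncomputable def qml (m l : ℕ) (w : ℝ) : ℝ :=
  (1 / 2) * ∫ μ in (-1 : ℝ)..1, pml m l μ / (w - μ) * (1 - μ ^ 2) ^ m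

/-- `h_l = 2l+1 − ϖ β_l` for `l ≤ L`, and `h_l = 2l+1` for `l > L`. -/
noncomputable def hcoef (ϖ : ℝ) (β : ℕ → ℝ) (L l : ℕ) : ℝ :=
  if l ≤ L then 2 * l + 1 - ϖ * β l else 2 * l + 1

/-- Auxiliary recursion: `chandraAux ϖ β L m ν n = g_{m+n}^m(ν)`, built from the
initial value `g_m^m(ν) = √((2m)!)/(2^m m!)`, the convention `g_{m−1}^m = 0`, and the
three-term recurrence `ν h_l g_l^m = √((l+1)²−m²) g_{l+1}^m + √(l²−m²) g_{l−1}^m`. -/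
noncomputable def chandraAux (ϖ : ℝ) (β : ℕ → ℝ) (L m : ℕ) (ν : ℝ) : ℕ → ℝ
  | 0 => Real.sqrt (Nat.factorial (2 * m)) / (2 ^ m * Nat.factorial m)
  | 1 => ν * hcoef ϖ β L m *
      (Real.sqrt (Nat.factorial (2 * m)) / (2 ^ m * Nat.factorial m)) /
      Real.sqrt (((m : ℝ) + 1) ^ 2 - (m : ℝ) ^ 2)
  | n + 2 =>
      (ν * hcoef ϖ β L (m + n + 1) * chandraAux ϖ β L m ν (n + 1) -
          Real.sqrt (((m + n + 1 : ℕ) : ℝ) ^ 2 - (m : ℝ) ^ 2) * chandraAux ϖ β L m ν n) /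
        Real.sqrt (((m + n + 2 : ℕ) : ℝ) ^ 2 - (m : ℝ) ^ 2)

/-- The normalized Chandrasekhar polynomial `g_l^m(ν)` (with value `0` for `l < m`). -/
noncomputable def gml (ϖ : ℝ) (β : ℕ → ℝ) (L m l : ℕ) (ν : ℝ) : ℝ :=
  if l < m then 0 else chandraAux ϖ β L m ν (l - m)

/-- `g^m(ν,μ) = Σ_{l=m}^{L} β_l p_l^m(μ) g_l^m(ν)`. -/
noncomputable def gfun (ϖ : ℝ) (β : ℕ → ℝ) (L m : ℕ) (ν μ : ℝ) : ℝ :=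
  ∑ l ∈ Finset.Icc m L, β l * pml m l μ * gml ϖ β L m l ν

/-- `Λ^m(w) = 1 − (ϖ w/2) ∫_{−1}^{1} g^m(w,μ)/(w−μ) (1−μ²)^m dμ`. -/
noncomputable def Lam (ϖ : ℝ) (β : ℕ → ℝ) (L m : ℕ) (w : ℝ) : ℝ :=
  1 - ϖ * w / 2 * ∫ μ in (-1 : ℝ)..1, gfun ϖ β L m w μ / (w - μ) * (1 - μ ^ 2) ^ m

/-- The off-diagonal entry `b_l = √((l²−m²)/(h_l h_{l−1}))`. -/
noncomputable def bcoef (ϖ : ℝ) (β : ℕ → ℝ) (L m l : ℕ) : ℝ :=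
  Real.sqrt (((l : ℝ) ^ 2 - (m : ℝ) ^ 2) / (hcoef ϖ β L l * hcoef ϖ β L (l - 1)))

/-- The symmetric tridiagonal matrix `B(m)` with rows/columns indexed by
`l ∈ {m, …, l_B}` (here `l = m + i` for `i : Fin (l_B − m + 1)`), zero diagonal and
off-diagonal entries `B(m)_{l,l−1} = B(m)_{l−1,l} = b_l`. -/
noncomputable def Bmat (ϖ : ℝ) (β : ℕ → ℝ) (L m lB : ℕ) :
    Matrix (Fin (lB - m + 1)) (Fin (lB - m + 1)) ℝ :=
  fun i j =>
    if (i : ℕ) + 1 = (j : ℕ) then bcoef ϖ β L m (m + j)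
    else if (j : ℕ) + 1 = (i : ℕ) then bcoef ϖ β L m (m + i)
    else 0

open Polynomial in
/-- The normalized power `(x² - 1)^l / (2^l l!)`, whose `l`-th derivative is `P_l`. -/
noncomputable def rodriguesPoly (l : ℕ) : ℝ[X] :=
  C (1 / (2 ^ l * (Nat.factorial l : ℝ))) * (X ^ 2 - 1) ^ l

open Polynomial in
/-- The polynomial `p_{m+n}^m`. -/
noncomputable def assocPoly (m n : ℕ) : ℝ[X] :=
  C (Real.sqrt ((Nat.factorial n : ℝ) / (Nat.factorial (n + 2 * m) : ℝ))) *
    derivative^[n + 2 * m] (rodriguesPoly (m + n))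

/-- The recurrence coefficient `√(l² - m²)` at `l = m + n`. -/
noncomputable def recCoef (m n : ℕ) : ℝ :=
  Real.sqrt (((m + n : ℕ) : ℝ) ^ 2 - (m : ℝ) ^ 2)

section Polynomials

open Polynomial

theorem iteratedDeriv_polynomial_eval (p : ℝ[X]) (n : ℕ) :
    iteratedDeriv n (fun x => p.eval x) = fun x => (derivative^[n] p).eval x := by
  induction n with
  | zero => simp
  | succ n ih =>
    rw [iteratedDeriv_succ, ih, Function.iterate_succ_apply']
    funext x
    exact Polynomial.deriv _

theorem legendreP_eq_eval (l : ℕ) :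
    legendreP l = fun x => (derivative^[l] (rodriguesPoly l)).eval x := by
  funext x
  have h : (fun y : ℝ => (y ^ 2 - 1) ^ l) = fun y => ((X ^ 2 - 1 : ℝ[X]) ^ l).eval y := by
    funext y
    simp
  rw [legendreP, h, iteratedDeriv_polynomial_eval, rodriguesPoly, iterate_derivative_C_mul]
  simp

theorem pml_eq_eval (m n : ℕ) (x : ℝ) : pml m (m + n) x = (assocPoly m n).eval x := by
  rw [pml, legendreP_eq_eval, iteratedDeriv_polynomial_eval, ← Function.iterate_add_apply,
    assocPoly, eval_mul, eval_C, show m + n - m = n by lia, show m + n + m = n + 2 * m by lia,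
    show m + (m + n) = n + 2 * m by lia]

theorem natDegree_rodriguesPoly_le (l : ℕ) : (rodriguesPoly l).natDegree ≤ 2 * l := by
  unfold rodriguesPoly
  compute_degree
  lia

theorem rodriguesPoly_succ (l : ℕ) :
    C (2 * ((l : ℝ) + 1)) * rodriguesPoly (l + 1) = (X ^ 2 - 1) * rodriguesPoly l := by
  have h : 2 * ((l : ℝ) + 1) * (1 / (2 ^ (l + 1) * (Nat.factorial (l + 1) : ℝ))) =
      1 / (2 ^ l * (Nat.factorial l : ℝ)) := by
    rw [Nat.factorial_succ]
    push_cast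
    field_simp
    ring
  rw [rodriguesPoly, rodriguesPoly, ← mul_assoc, ← C_mul, h]
  ring

theorem derivative_rodriguesPoly_succ (l : ℕ) :
    derivative (rodriguesPoly (l + 1)) = rodriguesPoly l * X := by
  have h : (1 / (2 ^ (l + 1) * (Nat.factorial (l + 1) : ℝ))) * (2 * ((l : ℝ) + 1)) =
      1 / (2 ^ l * (Nat.factorial l : ℝ)) := by
    rw [Nat.factorial_succ]
    push_cast
    field_simp
    ring
  rw [rodriguesPoly, rodriguesPoly, ← h]
  simp only [derivative_C_mul, derivative_pow, derivative_sub, derivative_X, derivative_one, C_mul]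
  simp
  ring

theorem derivative_rodriguesPoly_mul (l : ℕ) :
    (X ^ 2 - 1) * derivative (rodriguesPoly l) = C (2 * (l : ℝ)) * X * rodriguesPoly l := by
  cases l with
  | zero => simp [rodriguesPoly]
  | succ l =>
    have h := rodriguesPoly_succ l
    rw [derivative_rodriguesPoly_succ]
    push_cast
    linear_combination -X * h

theorem derivative_derivative_rodriguesPoly (l : ℕ) :
    derivative^[2] (rodriguesPoly (l + 2)) =
      C (2 * (l : ℝ) + 3) * rodriguesPoly (l + 1) + rodriguesPoly l := by
  have h := rodriguesPoly_succ l
  simp only [Function.iterate_succ_apply', Function.iterate_zero_apply,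
    derivative_rodriguesPoly_succ, derivative_mul, derivative_X]
  simp only [C_add, C_mul, C_1] at h ⊢
  have h3 : (C 3 : ℝ[X]) = C 2 + 1 := by rw [← C_1, ← C_add]; norm_num
  rw [h3]
  linear_combination -h

theorem iterate_derivative_rodriguesPoly_ode (l n : ℕ) :
    (X ^ 2 - 1) * derivative^[n + 2] (rodriguesPoly l) +
      C (2 * ((n : ℝ) + 1 - l)) * X * derivative^[n + 1] (rodriguesPoly l) +
      C (((n : ℝ) + 1) * (n - 2 * l)) * derivative^[n] (rodriguesPoly l) = 0 := by
  induction n with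
  | zero =>
    have h := congrArg derivative (derivative_rodriguesPoly_mul l)
    simp only [Function.iterate_succ_apply', Function.iterate_zero_apply]
    simp only [derivative_mul, derivative_sub, derivative_pow, derivative_X, derivative_C,
      derivative_one] at h
    simp [C_mul, C_sub] at h ⊢
    linear_combination h
  | succ n ih =>
    have h := congrArg derivative ih
    simp only [Function.iterate_succ_apply'] at h ⊢
    simp only [derivative_add, derivative_mul, derivative_sub, derivative_pow, derivative_X,
      derivative_C, derivative_one] at h
    simp [C_add, C_mul, C_sub] at h ⊢
    have e2 : (C 2 : ℝ[X]) = 2 := rfl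
    simp only [e2] at h ⊢
    linear_combination h

theorem recCoef_zero (m : ℕ) : recCoef m 0 = 0 := by simp [recCoef]

theorem recCoef_succ_pos (m n : ℕ) : 0 < recCoef m (n + 1) := by
  apply Real.sqrt_pos.mpr
  push_cast
  nlinarith [(m.cast_nonneg : (0 : ℝ) ≤ m), (n.cast_nonneg : (0 : ℝ) ≤ n)]

theorem recCoef_succ_mul_norm (m n : ℕ) :
    recCoef m (n + 1) *
        Real.sqrt ((Nat.factorial (n + 1) : ℝ) / (Nat.factorial (n + 1 + 2 * m) : ℝ)) =
      ((n : ℝ) + 1) * Real.sqrt ((Nat.factorial n : ℝ) / (Nat.factorial (n + 2 * m) : ℝ)) := by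
  rw [recCoef, ← Real.sqrt_mul' _ (by positivity), show n + 1 + 2 * m = n + 2 * m + 1 by lia]
  conv_rhs => rw [← Real.sqrt_sq (show (0 : ℝ) ≤ (n : ℝ) + 1 by positivity),
    ← Real.sqrt_mul (by positivity)]
  congr 1
  simp only [Nat.factorial_succ]
  push_cast
  field_simp
  ring

theorem recCoef_succ_mul_norm_prev (m n : ℕ) :
    recCoef m (n + 1) * Real.sqrt ((Nat.factorial n : ℝ) / (Nat.factorial (n + 2 * m) : ℝ)) =
      ((n : ℝ) + 1 + 2 * m) *
        Real.sqrt ((Nat.factorial (n + 1) : ℝ) / (Nat.factorial (n + 1 + 2 * m) : ℝ)) := by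
  rw [recCoef, ← Real.sqrt_mul' _ (by positivity), show n + 1 + 2 * m = n + 2 * m + 1 by lia]
  conv_rhs => rw [← Real.sqrt_sq (show (0 : ℝ) ≤ (n : ℝ) + 1 + 2 * m by positivity),
    ← Real.sqrt_mul (by positivity)]
  congr 1
  simp only [Nat.factorial_succ]
  push_cast
  field_simp
  ring

theorem iterate_derivative_rodriguesPoly_rec (m n : ℕ) :
    C (2 * ((m : ℝ) + (n + 1)) + 1) * X * derivative^[n + 1 + 2 * m] (rodriguesPoly (m + n + 1)) =
      C ((n : ℝ) + 2) * derivative^[n + 2 + 2 * m] (rodriguesPoly (m + n + 2)) +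
        C ((n : ℝ) + 1 + 2 * m) * derivative^[n + 2 * m] (rodriguesPoly (m + n)) := by
  have h1 : derivative^[n + 2 + 2 * m] (rodriguesPoly (m + n + 2)) =
      derivative^[n + 1 + 2 * m] (rodriguesPoly (m + n + 1)) * X +
        (n + 1 + 2 * m) • derivative^[n + 2 * m] (rodriguesPoly (m + n + 1)) := by
    rw [show n + 2 + 2 * m = n + 1 + 2 * m + 1 by lia, Function.iterate_succ_apply,
      derivative_rodriguesPoly_succ, iterate_derivative_mul_X,
      show n + 1 + 2 * m - 1 = n + 2 * m by lia]
  have h2 : derivative^[n + 2 + 2 * m] (rodriguesPoly (m + n + 2)) =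
      C (2 * ((m : ℝ) + n) + 3) * derivative^[n + 2 * m] (rodriguesPoly (m + n + 1)) +
        derivative^[n + 2 * m] (rodriguesPoly (m + n)) := by
    rw [show n + 2 + 2 * m = n + 2 * m + 2 by lia, Function.iterate_add_apply,
      derivative_derivative_rodriguesPoly, iterate_map_add, iterate_derivative_C_mul]
    push_cast
    rfl
  rw [nsmul_eq_mul] at h1
  push_cast at h1
  simp only [C_add, C_mul, C_1] at h1 h2 ⊢
  have e2 : (C 2 : ℝ[X]) = 2 := rfl
  have e3 : (C 3 : ℝ[X]) = 3 := rfl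
  simp only [C_eq_natCast, e2, e3] at h1 h2 ⊢
  linear_combination (-(2 * (m + n + 1) + 1) : ℝ[X]) * h1 + (n + 1 + 2 * m : ℝ[X]) * h2

theorem assocPoly_rec (m n : ℕ) :
    C (2 * ((m : ℝ) + n) + 1) * X * assocPoly m n =
      C (recCoef m (n + 1)) * assocPoly m (n + 1) +
        C (recCoef m n) * assocPoly m (n - 1) := by
  cases n with
  | zero =>
    have h : derivative^[2 * m + 1] (rodriguesPoly (m + 1)) =
        derivative^[2 * m] (rodriguesPoly m) * X +
          (2 * m) • derivative^[2 * m - 1] (rodriguesPoly m) := by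
      rw [Function.iterate_succ_apply, derivative_rodriguesPoly_succ, iterate_derivative_mul_X]
    have hode : (2 * m) • derivative^[2 * m - 1] (rodriguesPoly m) =
        C (2 * (m : ℝ)) * X * derivative^[2 * m] (rodriguesPoly m) := by
      obtain rfl | hm := m.eq_zero_or_pos
      · simp
      have hode := iterate_derivative_rodriguesPoly_ode m (2 * m - 1)
      rw [iterate_derivative_eq_zero (x := 2 * m - 1 + 2)
          ((natDegree_rodriguesPoly_le m).trans_lt (by lia)),
        show 2 * m - 1 + 1 = 2 * m by lia, Nat.cast_sub (by lia)] at hode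
      push_cast at hode
      rw [show (2 * ((2 * (m : ℝ) - 1) + 1 - m)) = 2 * m by ring,
        show ((2 * (m : ℝ) - 1) + 1) * ((2 * m - 1) - 2 * m) = -(2 * m) by ring, C_neg] at hode
      rw [nsmul_eq_mul, ← C_eq_natCast]
      push_cast
      linear_combination -hode
    have h1 := congrArg (C : ℝ → ℝ[X]) (recCoef_succ_mul_norm m 0)
    rw [C_mul, C_mul] at h1
    rw [hode] at h
    rw [recCoef_zero, C_0, zero_mul, add_zero, assocPoly, assocPoly, ← mul_assoc, ← mul_assoc,
      h1, show 0 + 1 + 2 * m = 2 * m + 1 by lia, show m + (0 + 1) = m + 1 by lia, h]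
    simp only [Nat.cast_zero, add_zero, zero_add, C_add, C_1]
    ring
  | succ n =>
    have h := iterate_derivative_rodriguesPoly_rec m n
    have h1 := congrArg (C : ℝ → ℝ[X]) (recCoef_succ_mul_norm m (n + 1))
    have h2 := congrArg (C : ℝ → ℝ[X]) (recCoef_succ_mul_norm_prev m n)
    rw [C_mul, C_mul] at h1 h2
    rw [Nat.add_sub_cancel, assocPoly, assocPoly, assocPoly, ← mul_assoc, ← mul_assoc, ← mul_assoc,
      h1, h2, show ((n + 1 : ℕ) : ℝ) + 1 = n + 2 by push_cast; ring]
    push_cast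
    simp only [← add_assoc] at h ⊢
    linear_combination C (√((Nat.factorial (n + 1) : ℝ) / (Nat.factorial (n + 1 + 2 * m) : ℝ))) * h

theorem assocPoly_ode (m n : ℕ) :
    (1 - X ^ 2) * derivative^[2] (assocPoly m n) =
      C (2 * ((m : ℝ) + 1)) * X * derivative (assocPoly m n) -
        C ((n : ℝ) * (n + 2 * m + 1)) * assocPoly m n := by
  have h := iterate_derivative_rodriguesPoly_ode (m + n) (n + 2 * m)
  simp only [assocPoly, Function.iterate_succ_apply', Function.iterate_zero_apply,
    derivative_C_mul] at h ⊢
  push_cast at h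
  rw [show 2 * ((n : ℝ) + 2 * m + 1 - (m + n)) = 2 * ((m : ℝ) + 1) by ring,
    show ((n : ℝ) + 2 * m + 1) * (n + 2 * m - 2 * (m + n)) = -((n : ℝ) * (n + 2 * m + 1)) by ring,
    C_neg] at h
  linear_combination -C (√((Nat.factorial n : ℝ) / (Nat.factorial (n + 2 * m) : ℝ))) * h

theorem iterate_derivative_two_mul_rodriguesPoly (m : ℕ) :
    derivative^[2 * m] (rodriguesPoly m) =
      C ((Nat.factorial (2 * m) : ℝ) / (2 ^ m * Nat.factorial m)) := by
  induction m using Nat.twoStepInduction with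
  | zero => simp [rodriguesPoly]
  | one =>
    have h : derivative^[2] (rodriguesPoly 1) = 1 := by
      simp [derivative_rodriguesPoly_succ]
      simp [rodriguesPoly]
    simpa using h
  | more l _ ih =>
    rw [show 2 * (l + 2) = 2 * (l + 1) + 2 by lia, Function.iterate_add_apply,
      derivative_derivative_rodriguesPoly, iterate_map_add, iterate_derivative_C_mul, ih,
      iterate_derivative_eq_zero ((natDegree_rodriguesPoly_le l).trans_lt (by lia)), add_zero,
      ← C_mul]
    congr 1
    rw [show 2 * (l + 1) + 2 = (2 * (l + 1) + 1) + 1 by lia]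
    simp only [Nat.factorial_succ]
    push_cast
    field_simp
    ring

theorem assocPoly_zero (m : ℕ) :
    assocPoly m 0 = C (Real.sqrt (Nat.factorial (2 * m)) / (2 ^ m * Nat.factorial m)) := by
  rw [assocPoly, zero_add, add_zero, iterate_derivative_two_mul_rodriguesPoly, ← C_mul]
  congr 1
  have h : (0 : ℝ) < Nat.factorial (2 * m) := by positivity
  rw [Nat.factorial_zero, Nat.cast_one, Real.sqrt_div zero_le_one, Real.sqrt_one]
  nth_rewrite 2 [← Real.mul_self_sqrt h.le]
  have := Real.sqrt_pos.mpr h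
  field_simp

/-- The functional `p ↦ ∫_{-1}^{1} f p`. -/
noncomputable def polyMoment (f : ℝ → ℝ) (p : ℝ[X]) : ℝ :=
  ∫ x in (-1 : ℝ)..1, f x * p.eval x

theorem polyMoment_add {f : ℝ → ℝ} (hf : ContinuousOn f (Set.uIcc (-1) 1)) (p q : ℝ[X]) :
    polyMoment f (p + q) = polyMoment f p + polyMoment f q := by
  simp only [polyMoment, eval_add, mul_add]
  exact intervalIntegral.integral_add (hf.mul p.continuousOn).intervalIntegrable
    (hf.mul q.continuousOn).intervalIntegrable

theorem polyMoment_C_mul (f : ℝ → ℝ) (c : ℝ) (p : ℝ[X]) :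
    polyMoment f (C c * p) = c * polyMoment f p := by
  simp only [polyMoment, eval_mul, eval_C, mul_left_comm _ c]
  exact intervalIntegral.integral_const_mul _ _

theorem polyMoment_sum {f : ℝ → ℝ} (hf : ContinuousOn f (Set.uIcc (-1) 1)) {ι : Type*}
    (s : Finset ι) (p : ι → ℝ[X]) :
    polyMoment f (∑ i ∈ s, p i) = ∑ i ∈ s, polyMoment f (p i) := by
  simp only [polyMoment, eval_finsetSum, Finset.mul_sum]
  exact intervalIntegral.integral_finsetSum fun i _ =>
    (hf.mul (p i).continuousOn).intervalIntegrable

theorem polyMoment_assocPoly_rec {f : ℝ → ℝ} (hf : ContinuousOn f (Set.uIcc (-1) 1))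
    (m n : ℕ) (q : ℝ[X]) :
    (2 * ((m : ℝ) + n) + 1) * polyMoment f (X * assocPoly m n * q) =
      recCoef m (n + 1) * polyMoment f (assocPoly m (n + 1) * q) +
        recCoef m n * polyMoment f (assocPoly m (n - 1) * q) := by
  rw [← polyMoment_C_mul, ← polyMoment_C_mul, ← polyMoment_C_mul, ← polyMoment_add hf]
  congr 1
  linear_combination q * assocPoly_rec m n

/-- The weight `(1 - x²)^m`. -/
noncomputable def legendreWeight (m : ℕ) (x : ℝ) : ℝ := (1 - x ^ 2) ^ m

theorem continuous_legendreWeight (m : ℕ) : Continuous (legendreWeight m) := by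
  unfold legendreWeight
  fun_prop

theorem integral_derivative_eval (p : ℝ[X]) (a b : ℝ) :
    ∫ x in a..b, (derivative p).eval x = p.eval b - p.eval a :=
  intervalIntegral.integral_eq_sub_of_hasDerivAt (fun x _ => p.hasDerivAt x)
    ((derivative p).continuous.intervalIntegrable _ _)

theorem polyMoment_assocPoly_of_ne (m : ℕ) {n k : ℕ} (hnk : n ≠ k) :
    polyMoment (legendreWeight m) (assocPoly m n * assocPoly m k) = 0 := by
  set p := assocPoly m n with hp
  set q := assocPoly m k with hq
  have hF : derivative ((1 - X ^ 2) ^ (m + 1) * (derivative p * q - p * derivative q)) =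
      C ((k : ℝ) * (k + 2 * m + 1) - n * (n + 2 * m + 1)) * ((1 - X ^ 2) ^ m * (p * q)) := by
    have h1 := assocPoly_ode m n
    have h2 := assocPoly_ode m k
    rw [← hp] at h1
    rw [← hq] at h2
    simp only [Function.iterate_succ_apply', Function.iterate_zero_apply] at h1 h2
    simp only [derivative_mul, derivative_sub, derivative_pow, derivative_X, derivative_one]
    have e2 : (C 2 : ℝ[X]) = 2 := rfl
    simp [C_mul, C_sub, C_add, e2] at h1 h2 ⊢
    linear_combination (1 - X ^ 2) ^ m * q * h1 - (1 - X ^ 2) ^ m * p * h2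
  have hI := integral_derivative_eval
    ((1 - X ^ 2) ^ (m + 1) * (derivative p * q - p * derivative q)) (-1) 1
  rw [hF] at hI
  simp only [eval_mul, eval_C, eval_sub, eval_pow, eval_one, eval_X,
    intervalIntegral.integral_const_mul] at hI
  have hc : (k : ℝ) * (k + 2 * m + 1) - n * (n + 2 * m + 1) ≠ 0 := by
    have h1 : (k : ℝ) - n ≠ 0 := sub_ne_zero.mpr (by exact_mod_cast hnk.symm)
    have h2 : (k : ℝ) + n + 2 * m + 1 ≠ 0 := by positivity
    convert mul_ne_zero h1 h2 using 1
    ring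
  norm_num at hI
  simp only [polyMoment, legendreWeight, eval_mul]
  exact hI.resolve_left hc

theorem integral_legendreWeight_succ (m : ℕ) :
    (2 * (m : ℝ) + 3) * (∫ x in (-1 : ℝ)..1, legendreWeight (m + 1) x) =
      2 * (m + 1) * ∫ x in (-1 : ℝ)..1, legendreWeight m x := by
  have hF : ∀ x, (derivative (X * (1 - X ^ 2 : ℝ[X]) ^ (m + 1))).eval x =
      (2 * (m : ℝ) + 3) * legendreWeight (m + 1) x - 2 * (m + 1) * legendreWeight m x := by
    intro x
    simp only [derivative_mul, derivative_pow_succ, derivative_sub, derivative_X,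
      derivative_one]
    simp [legendreWeight]
    ring
  have hI := integral_derivative_eval (X * (1 - X ^ 2 : ℝ[X]) ^ (m + 1)) (-1) 1
  simp only [hF] at hI
  rw [intervalIntegral.integral_sub
    (((continuous_legendreWeight _).const_mul _).intervalIntegrable _ _)
    (((continuous_legendreWeight _).const_mul _).intervalIntegrable _ _),
    intervalIntegral.integral_const_mul, intervalIntegral.integral_const_mul] at hI
  norm_num at hI
  linarith

theorem integral_legendreWeight (m : ℕ) :
    ∫ x in (-1 : ℝ)..1, legendreWeight m x =
      2 * (2 ^ m * (Nat.factorial m : ℝ)) ^ 2 / Nat.factorial (2 * m + 1) := by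
  induction m with
  | zero => simp [legendreWeight]; norm_num
  | succ m ih =>
    have h := integral_legendreWeight_succ m
    rw [ih] at h
    rw [← mul_right_inj' (show (2 * (m : ℝ) + 3) ≠ 0 by positivity), h,
      show 2 * (m + 1) + 1 = 2 * m + 1 + 1 + 1 by lia]
    simp only [Nat.factorial_succ]
    push_cast
    field_simp
    ring

theorem polyMoment_assocPoly_self (m n : ℕ) :
    (2 * ((m : ℝ) + n) + 1) * polyMoment (legendreWeight m) (assocPoly m n * assocPoly m n) =
      2 := by
  induction n with
  | zero =>
    have h : (0 : ℝ) ≤ Nat.factorial (2 * m) := by positivity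
    simp only [polyMoment, assocPoly_zero, eval_mul, eval_C, intervalIntegral.integral_mul_const,
      integral_legendreWeight, Nat.factorial_succ]
    rw [div_mul_div_comm, Real.mul_self_sqrt h]
    push_cast
    field_simp
    ring
  | succ n ih =>
    have hW := (continuous_legendreWeight m).continuousOn (s := Set.uIcc (-1) 1)
    have h1 := polyMoment_assocPoly_rec hW m n (assocPoly m (n + 1))
    have h2 := polyMoment_assocPoly_rec hW m (n + 1) (assocPoly m n)
    rw [polyMoment_assocPoly_of_ne m (show n - 1 ≠ n + 1 by lia)] at h1
    rw [polyMoment_assocPoly_of_ne m (show n + 1 + 1 ≠ n by lia), Nat.add_sub_cancel,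
      show X * assocPoly m (n + 1) * assocPoly m n = X * assocPoly m n * assocPoly m (n + 1) by
        ring] at h2
    have hα := (recCoef_succ_pos m n).ne'
    push_cast at h2 ⊢
    rw [← mul_right_inj' hα]
    linear_combination (-(2 * ((m : ℝ) + (n + 1)) + 1)) * h1 + (2 * ((m : ℝ) + n) + 1) * h2 +
      recCoef m (n + 1) * ih

/-- The polynomial `μ ↦ g^m(ν, μ)`. -/
noncomputable def gPoly (ϖ : ℝ) (β : ℕ → ℝ) (L m : ℕ) (ν : ℝ) : ℝ[X] :=
  ∑ n ∈ Finset.range (L + 1 - m), C (β (m + n) * chandraAux ϖ β L m ν n) * assocPoly m n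

theorem gfun_eq_eval (ϖ : ℝ) (β : ℕ → ℝ) (L m : ℕ) (ν x : ℝ) :
    gfun ϖ β L m ν x = (gPoly ϖ β L m ν).eval x := by
  rw [gfun, gPoly, eval_finsetSum, ← Finset.Ico_add_one_right_eq_Icc,
    Finset.sum_Ico_eq_sum_range]
  refine Finset.sum_congr rfl fun n _ => ?_
  rw [pml_eq_eval, gml, if_neg (by lia), Nat.add_sub_cancel_left, eval_mul, eval_C]
  ring

theorem polyMoment_gPoly_mul_assocPoly (ϖ : ℝ) (β : ℕ → ℝ) (L m : ℕ) (ν : ℝ) {n : ℕ}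
    (hn : m + n ≤ L) :
    (2 * ((m : ℝ) + n) + 1) *
        polyMoment (legendreWeight m) (gPoly ϖ β L m ν * assocPoly m n) =
      2 * β (m + n) * chandraAux ϖ β L m ν n := by
  rw [gPoly, Finset.sum_mul, polyMoment_sum (continuous_legendreWeight m).continuousOn,
    Finset.sum_eq_single n]
  · rw [mul_assoc, polyMoment_C_mul]
    linear_combination β (m + n) * chandraAux ϖ β L m ν n * polyMoment_assocPoly_self m n
  · intro k _ hk
    rw [mul_assoc, polyMoment_C_mul, polyMoment_assocPoly_of_ne m hk, mul_zero]
  · intro h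
    exact absurd (Finset.mem_range.mpr (by lia)) h

theorem chandraAux_rec (ϖ : ℝ) (β : ℕ → ℝ) (L m : ℕ) (ν : ℝ) (n : ℕ) :
    recCoef m (n + 1) * chandraAux ϖ β L m ν (n + 1) +
        recCoef m n * chandraAux ϖ β L m ν (n - 1) =
      ν * hcoef ϖ β L (m + n) * chandraAux ϖ β L m ν n := by
  cases n with
  | zero =>
    have h := (recCoef_succ_pos m 0).ne'
    rw [recCoef_zero, zero_mul, add_zero, zero_add] at *
    rw [recCoef] at h ⊢
    push_cast at h ⊢
    rw [chandraAux, chandraAux, mul_div_cancel₀ _ h]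
    simp
  | succ n =>
    have h := (recCoef_succ_pos m (n + 1)).ne'
    rw [recCoef, recCoef, Nat.add_sub_cancel] at *
    rw [chandraAux, ← add_assoc, ← add_assoc] at *
    rw [show m + n + 1 + 1 = m + n + 2 by rfl] at *
    rw [mul_div_cancel₀ _ h]
    ring

/-- The eigenfunction `φ^m(w, ·)` times the weight `(1 - x²)^m`. -/
noncomputable def weightedEigenfunction (ϖ : ℝ) (β : ℕ → ℝ) (L m : ℕ) (w x : ℝ) : ℝ :=
  ϖ * w / 2 * gfun ϖ β L m w x / (w - x) * legendreWeight m x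

theorem sub_ne_zero_of_one_lt_abs {w x : ℝ} (hw : 1 < |w|) (hx : x ∈ Set.uIcc (-1 : ℝ) 1) :
    w - x ≠ 0 := by
  intro h
  rw [Set.uIcc_of_le (by norm_num), Set.mem_Icc, ← abs_le, ← sub_eq_zero.mp h] at hx
  exact hx.not_gt hw

theorem continuousOn_eigenfunction (ϖ : ℝ) (β : ℕ → ℝ) (L m : ℕ) {w : ℝ} (hw : 1 < |w|) :
    ContinuousOn (fun x => ϖ * w / 2 * gfun ϖ β L m w x / (w - x)) (Set.uIcc (-1) 1) := by
  simp only [gfun_eq_eval]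
  exact ContinuousOn.div (by fun_prop) (by fun_prop) fun x hx => sub_ne_zero_of_one_lt_abs hw hx

theorem continuousOn_weightedEigenfunction (ϖ : ℝ) (β : ℕ → ℝ) (L m : ℕ) {w : ℝ} (hw : 1 < |w|) :
    ContinuousOn (weightedEigenfunction ϖ β L m w) (Set.uIcc (-1) 1) :=
  (continuousOn_eigenfunction ϖ β L m hw).mul (continuous_legendreWeight m).continuousOn

theorem polyMoment_weightedEigenfunction_X_mul (ϖ : ℝ) (β : ℕ → ℝ) (L m : ℕ) {w : ℝ}
    (hw : 1 < |w|) (p : ℝ[X]) :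
    polyMoment (weightedEigenfunction ϖ β L m w) (X * p) =
      w * polyMoment (weightedEigenfunction ϖ β L m w) p -
        ϖ * w / 2 * polyMoment (legendreWeight m) (gPoly ϖ β L m w * p) := by
  have hf := continuousOn_weightedEigenfunction ϖ β L m hw
  have hW := (continuous_legendreWeight m).continuousOn (s := Set.uIcc (-1) 1)
  rw [← polyMoment_C_mul, ← polyMoment_C_mul]
  simp only [polyMoment]
  refine Eq.trans ?_ (intervalIntegral.integral_sub
    (hf.mul (Polynomial.continuousOn _)).intervalIntegrable
    (hW.mul (Polynomial.continuousOn _)).intervalIntegrable)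
  refine intervalIntegral.integral_congr fun x hx => ?_
  have hx := sub_ne_zero_of_one_lt_abs hw hx
  simp only [weightedEigenfunction, gfun_eq_eval, eval_mul, eval_C, eval_X]
  field_simp
  ring

theorem polyMoment_weightedEigenfunction_assocPoly (ϖ : ℝ) (β : ℕ → ℝ) (L m : ℕ) {w : ℝ}
    (hw : 1 < |w|) (hΛ : Lam ϖ β L m w = 0) (n : ℕ) (hn : m + n ≤ L) :
    polyMoment (weightedEigenfunction ϖ β L m w) (assocPoly m n) = chandraAux ϖ β L m w n := by
  induction n using Nat.strong_induction_on with
  | _ n ih =>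
  cases n with
  | zero =>
    have h1 : ∫ x in (-1 : ℝ)..1, weightedEigenfunction ϖ β L m w x = 1 := by
      rw [Lam, ← intervalIntegral.integral_const_mul] at hΛ
      refine Eq.trans ?_ (sub_eq_zero.mp hΛ).symm
      refine intervalIntegral.integral_congr fun x _ => ?_
      simp only [weightedEigenfunction, legendreWeight]
      ring
    simp only [polyMoment, assocPoly_zero, eval_C, intervalIntegral.integral_mul_const, h1,
      one_mul, chandraAux]
  | succ n =>
    have h := polyMoment_assocPoly_rec (continuousOn_weightedEigenfunction ϖ β L m hw) m n 1
    have hg := polyMoment_gPoly_mul_assocPoly ϖ β L m w (n := n) (by lia)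
    have hc := chandraAux_rec ϖ β L m w n
    simp only [mul_one] at h
    rw [polyMoment_weightedEigenfunction_X_mul ϖ β L m hw, ih n (by lia) (by lia),
      ih (n - 1) (by lia) (by lia)] at h
    rw [hcoef, if_pos (by lia)] at hc
    push_cast at hc
    rw [← mul_right_inj' (recCoef_succ_pos m n).ne']
    linear_combination -h - hc - ϖ * w / 2 * hg

theorem integral_sub_mul_eigenfunction_mul (ϖ : ℝ) (β : ℕ → ℝ) (L m : ℕ) {w w' : ℝ}
    (hw : 1 < |w|) (hw' : 1 < |w'|) (hΛ : Lam ϖ β L m w' = 0) :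
    ∫ x in (-1 : ℝ)..1, (w - x) * (ϖ * w / 2 * gfun ϖ β L m w x / (w - x)) *
        weightedEigenfunction ϖ β L m w' x =
      ϖ * w / 2 * ∑ n ∈ Finset.range (L + 1 - m),
        β (m + n) * chandraAux ϖ β L m w n * chandraAux ϖ β L m w' n := by
  calc
    _ = polyMoment (weightedEigenfunction ϖ β L m w') (C (ϖ * w / 2) * gPoly ϖ β L m w) := by
      refine intervalIntegral.integral_congr fun x hx => ?_
      have hx := sub_ne_zero_of_one_lt_abs hw hx
      simp only [eval_mul, eval_C, gfun_eq_eval]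
      field_simp
    _ = _ := by
      rw [polyMoment_C_mul, gPoly,
        polyMoment_sum (continuousOn_weightedEigenfunction ϖ β L m hw')]
      congr 1
      refine Finset.sum_congr rfl fun n hn => ?_
      rw [Finset.mem_range] at hn
      rw [polyMoment_C_mul,
        polyMoment_weightedEigenfunction_assocPoly ϖ β L m hw' hΛ n (by lia)]

theorem integral_sub_mul_eigenfunction_mul_eq (ϖ : ℝ) (β : ℕ → ℝ) (L m : ℕ) {w w' : ℝ}
    (hw : 1 < |w|) (hw' : 1 < |w'|) (c : ℝ) :
    ∫ x in (-1 : ℝ)..1, (c - x) * (ϖ * w / 2 * gfun ϖ β L m w x / (w - x)) *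
        weightedEigenfunction ϖ β L m w' x =
      c * (∫ x in (-1 : ℝ)..1, ϖ * w / 2 * gfun ϖ β L m w x / (w - x) *
        weightedEigenfunction ϖ β L m w' x) -
      ∫ x in (-1 : ℝ)..1, x * (ϖ * w / 2 * gfun ϖ β L m w x / (w - x)) *
        (ϖ * w' / 2 * gfun ϖ β L m w' x / (w' - x)) * (1 - x ^ 2) ^ m := by
  have h := (continuousOn_eigenfunction ϖ β L m hw).mul
    (continuousOn_weightedEigenfunction ϖ β L m hw')
  have h' : ContinuousOn (fun x => x * (ϖ * w / 2 * gfun ϖ β L m w x / (w - x)) *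
      (ϖ * w' / 2 * gfun ϖ β L m w' x / (w' - x)) * (1 - x ^ 2) ^ m) (Set.uIcc (-1) 1) :=
    ((continuousOn_id.mul (continuousOn_eigenfunction ϖ β L m hw)).mul
      (continuousOn_eigenfunction ϖ β L m hw')).mul (continuous_legendreWeight m).continuousOn
  rw [← intervalIntegral.integral_const_mul]
  refine Eq.trans ?_ (intervalIntegral.integral_sub (h.const_mul c).intervalIntegrable
    h'.intervalIntegrable)
  refine intervalIntegral.integral_congr fun x _ => ?_
  simp only [weightedEigenfunction, legendreWeight]
  ring

end Polynomials

/-- STATEMENT 11 (full-range orthogonality of discrete singular eigenfunctions),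
with `φ^m(w,μ) = (ϖ w/2) g^m(w,μ)/(w−μ)`. -/
theorem stmt_11 (L : ℕ) (hL : 1 ≤ L) (ϖ : ℝ) (hϖ : ϖ ∈ Set.Ioo (0 : ℝ) 1)
    (β : ℕ → ℝ) (hβ0 : β 0 = 1)
    (hβ : ∀ l : ℕ, 1 ≤ l → l ≤ L → β l ∈ Set.Ioo (0 : ℝ) (2 * (l : ℝ) + 1))
    (m : ℕ) (hm : m ≤ L)
    (w w' : ℝ) (hw : 1 < |w|) (hw' : 1 < |w'|) (hne : w ≠ w')
    (hw0 : Lam ϖ β L m w = 0) (hw'0 : Lam ϖ β L m w' = 0) :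
    ∫ μ in (-1 : ℝ)..1,
        μ * (ϖ * w / 2 * gfun ϖ β L m w μ / (w - μ)) *
          (ϖ * w' / 2 * gfun ϖ β L m w' μ / (w' - μ)) * (1 - μ ^ 2) ^ m = 0 := by
  have h1 := integral_sub_mul_eigenfunction_mul ϖ β L m hw hw' hw'0
  have h2 := integral_sub_mul_eigenfunction_mul ϖ β L m hw' hw hw0
  have hswap : ∫ x in (-1 : ℝ)..1, (w' - x) * (ϖ * w' / 2 * gfun ϖ β L m w' x / (w' - x)) *
        weightedEigenfunction ϖ β L m w x =
      ∫ x in (-1 : ℝ)..1, (w' - x) * (ϖ * w / 2 * gfun ϖ β L m w x / (w - x)) *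
        weightedEigenfunction ϖ β L m w' x := by
    refine intervalIntegral.integral_congr fun x _ => ?_
    simp only [weightedEigenfunction]
    ring
  rw [hswap, integral_sub_mul_eigenfunction_mul_eq ϖ β L m hw hw'] at h2
  rw [integral_sub_mul_eigenfunction_mul_eq ϖ β L m hw hw'] at h1
  have hsum : ∑ n ∈ Finset.range (L + 1 - m),
        β (m + n) * chandraAux ϖ β L m w' n * chandraAux ϖ β L m w n =
      ∑ n ∈ Finset.range (L + 1 - m),
        β (m + n) * chandraAux ϖ β L m w n * chandraAux ϖ β L m w' n :=
    Finset.sum_congr rfl fun n _ => mul_right_comm _ _ _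
  rw [hsum] at h2
  refine (mul_eq_zero.mp ?_).resolve_left (sub_ne_zero.mpr hne)
  linear_combination w' * h1 - w * h2
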